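/- There is a universal constant C > 0 such that the following holds for every n ≥ 1, every ε ∈ (0, 1/2], every symmetric f : {0,1}^n → {0,1}, and every nondecreasing sequence of nonnegative costs 0 ≤ c_1 ≤ c_2 ≤ … ≤ c_n: Σ_{i=1}^{n} c_i·( Pr[τ^(ε) ≥ i] + (n − i)·Pr[τ^(ε) = i] ) ≤ C·(1 + log₂(1/ε))·Σ_{i=1}^{n} c_i·Pr[τ^(0) ≥ i], where all probabilities are over x ~ uniform({0,1}^n). -/

import Mathlib

open Finset
open scoped Classical

noncomputable section

variable {ι : Type*} [Fintype ι] [DecidableEq ι]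

/-- Probability of an event under the uniform distribution on `ι → Bool`. -/
def prU (p : (ι → Bool) → Prop) : ℝ :=
  ((Finset.univ.filter fun x => p x).card : ℝ) / (Fintype.card (ι → Bool) : ℝ)

/-- Expectation of a real-valued function under the uniform distribution on `ι → Bool`. -/
def expU (g : (ι → Bool) → ℝ) : ℝ :=
  (∑ x : ι → Bool, g x) / (Fintype.card (ι → Bool) : ℝ)

/-- `Inf_i[f]`: the influence of coordinate `i` on `f`. -/
def influence (f : (ι → Bool) → Bool) (i : ι) : ℝ :=
  prU fun x => f x ≠ f (Function.update x i (!x i))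

/-- `dist(f, g)`: probability that `f` and `g` disagree on a uniform random input. -/
def distU (f g : (ι → Bool) → Bool) : ℝ := prU fun x => f x ≠ g x

/-- `bias(f)`: the distance of `f` to the nearest constant function. -/
def biasU (f : (ι → Bool) → Bool) : ℝ :=
  min (distU f fun _ => false) (distU f fun _ => true)

/-- The restriction `f_π` of `f` under the partial assignment `π`, viewed as a function
on the full cube (the fixed coordinates are irrelevant, so probabilities/influences over
the full cube agree with those over the unfixed coordinates). -/
def restrictB (f : (ι → Bool) → Bool) (π : ι → Option Bool) : (ι → Bool) → Bool :=
  fun x => f fun i => (π i).getD (x i)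

/-- A symmetric Boolean function: `f x` depends only on the Hamming weight of `x`. -/
def IsSymmetricFn {n : ℕ} (f : (Fin n → Bool) → Bool) : Prop :=
  ∀ x y : Fin n → Bool,
    (Finset.univ.filter fun i => x i = true).card =
      (Finset.univ.filter fun i => y i = true).card → f x = f y

/-- The restriction of `f` fixing the first `t` coordinates to those of `x`. -/
def restrictFirst {n : ℕ} (f : (Fin n → Bool) → Bool) (x : Fin n → Bool) (t : ℕ) :
    (Fin n → Bool) → Bool :=
  fun y => f fun i => if (i : ℕ) < t then x i else y i

/-- `τ^(ε)(x)`: the smallest `t ∈ {0, …, n}` such that fixing the first `t` coordinates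
to `x_1, …, x_t` yields a function of bias at most `ε` (at `t = n` the restriction is a
constant, so the set is nonempty whenever `ε ≥ 0`). -/
def tauStop {n : ℕ} (f : (Fin n → Bool) → Bool) (ε : ℝ) (x : Fin n → Bool) : ℕ :=
  sInf {t : ℕ | biasU (restrictFirst f x t) ≤ ε}

lemma prU_eq_sum_ite (p : (ι → Bool) → Prop) [DecidablePred p] :
    prU p = (∑ x, if p x then (1 : ℝ) else 0) / (Fintype.card (ι → Bool) : ℝ) := by
  rw [prU, Finset.sum_boole]
  congr!

lemma prU_mono {p q : (ι → Bool) → Prop} (h : ∀ x, p x → q x) : prU p ≤ prU q := by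
  unfold prU
  gcongr with x
  exact h x

lemma prU_or_le (p q : (ι → Bool) → Prop) : prU (fun x => p x ∨ q x) ≤ prU p + prU q := by
  unfold prU
  rw [← add_div]
  gcongr
  simp only [Finset.filter_or]
  exact_mod_cast Finset.card_union_le _ _

lemma not_of_prU_nonpos {p : (ι → Bool) → Prop} (h : prU p ≤ 0) (x : ι → Bool) : ¬ p x := by
  intro hx
  have hcard : 0 < (Finset.univ.filter fun x => p x).card :=
    Finset.card_pos.mpr ⟨x, by simpa using hx⟩
  have : 0 < prU p := by unfold prU; positivity
  linarith

/-- A function of nonpositive bias is constant. -/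
lemma eq_of_biasU_nonpos {f : (ι → Bool) → Bool} (h : biasU f ≤ 0) (y z : ι → Bool) :
    f y = f z := by
  rcases min_le_iff.mp h with h | h
  · have := not_of_prU_nonpos h
    simp_all
  · have := not_of_prU_nonpos h
    simp_all

lemma biasU_le_prU_of_const_on {f : (ι → Bool) → Bool} {p : (ι → Bool) → Prop}
    (h : ∀ y z, p y → p z → f y = f z) : biasU f ≤ prU fun y => ¬ p y := by
  by_cases hf : ∃ y, p y ∧ f y = true
  · obtain ⟨y, hy, hfy⟩ := hf
    refine (min_le_right _ _).trans (prU_mono fun z hz hpz => hz ?_)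
    rw [← h y z hy hpz, hfy]
  · refine (min_le_left _ _).trans (prU_mono fun z hz hpz => hf ⟨z, hpz, ?_⟩)
    simpa using hz

lemma biasU_nonpos_of_const {f : (ι → Bool) → Bool} (h : ∀ y z, f y = f z) : biasU f ≤ 0 := by
  refine (biasU_le_prU_of_const_on (p := fun _ => True) fun y z _ _ => h y z).trans ?_
  simp [prU]

variable {n : ℕ}

/-- The number of coordinates from position `t` on where `y` takes the value `b`. -/
def tailCount (t : ℕ) (b : Bool) (y : Fin n → Bool) : ℕ :=
  (Finset.univ.filter fun i : Fin n => t ≤ (i : ℕ) ∧ y i = b).card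

lemma card_filter_le_val {t : ℕ} (ht : t ≤ n) :
    (Finset.univ.filter fun i : Fin n => t ≤ (i : ℕ)).card = n - t := by
  have h := Finset.card_filter_add_card_filter_not (s := (Finset.univ : Finset (Fin n)))
    (fun i : Fin n => (i : ℕ) < t)
  simp only [not_lt, Finset.card_univ, Fintype.card_fin, Fin.card_filter_val_lt] at h
  omega

lemma tailCount_true_add_false {t : ℕ} (ht : t ≤ n) (y : Fin n → Bool) :
    tailCount t true y + tailCount t false y = n - t := by
  rw [← card_filter_le_val ht, tailCount, tailCount, ← Finset.filter_filter,
    ← Finset.filter_filter]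
  have := Finset.card_filter_add_card_filter_not
    (s := Finset.univ.filter fun i : Fin n => t ≤ (i : ℕ)) (fun i => y i = true)
  simpa using this

lemma sum_pow_tailCount {t : ℕ} (ht : t ≤ n) (b : Bool) :
    ∑ y : Fin n → Bool, (1 / 3 : ℝ) ^ tailCount t b y = 2 ^ t * (4 / 3) ^ (n - t) := by
  have hprod (y : Fin n → Bool) : (1 / 3 : ℝ) ^ tailCount t b y =
      ∏ i : Fin n, if t ≤ (i : ℕ) ∧ y i = b then (1 / 3 : ℝ) else 1 := by
    rw [tailCount, Finset.prod_ite]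
    simp
  have hfac (i : Fin n) : ∑ c : Bool, (if t ≤ (i : ℕ) ∧ c = b then (1 / 3 : ℝ) else 1) =
      if t ≤ (i : ℕ) then 4 / 3 else 2 := by
    by_cases hi : t ≤ (i : ℕ) <;> cases b <;> simp [hi] <;> norm_num
  simp_rw [hprod]
  rw [← Fintype.prod_sum (f := fun (i : Fin n) (c : Bool) =>
    if t ≤ (i : ℕ) ∧ c = b then (1 / 3 : ℝ) else 1)]
  simp_rw [hfac]
  rw [Finset.prod_ite, Finset.prod_const, Finset.prod_const, card_filter_le_val ht, mul_comm]
  congr 2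
  simp only [not_le, Fin.card_filter_val_lt]
  omega

/-- Chernoff-type lower tail bound for the number of `b`s among the last `n - t` coordinates. -/
lemma prU_tailCount_lt_le {t : ℕ} (ht : t ≤ n) (b : Bool) (a : ℕ) :
    prU (fun y : Fin n → Bool => tailCount t b y < a) ≤ 3 ^ a * (2 / 3) ^ (n - t) := by
  rw [prU_eq_sum_ite]
  have hcard : (Fintype.card (Fin n → Bool) : ℝ) = 2 ^ t * 2 ^ (n - t) := by
    rw [← pow_add, Nat.add_sub_cancel' ht]; simp
  have hsum : (∑ y : Fin n → Bool, if tailCount t b y < a then (1 : ℝ) else 0) ≤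
      3 ^ a * (2 ^ t * (4 / 3) ^ (n - t)) := by
    rw [← sum_pow_tailCount ht b, Finset.mul_sum]
    refine Finset.sum_le_sum fun y _ => ?_
    split_ifs with h
    · calc (1 : ℝ) = 3 ^ a * (1 / 3) ^ a := by rw [← mul_pow]; norm_num
        _ ≤ _ := by
          gcongr ?_ * ?_
          exact pow_le_pow_of_le_one (by norm_num) (by norm_num) h.le
    · positivity
  rw [hcard, div_le_iff₀ (by positivity)]
  refine hsum.trans (le_of_eq ?_)
  have : (4 / 3 : ℝ) ^ (n - t) = (2 / 3) ^ (n - t) * 2 ^ (n - t) := by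
    rw [← mul_pow]; norm_num
  rw [this]; ring

lemma prU_not_central_le {t a : ℕ} (ht : t ≤ n) (ha : 8 * a ≤ n - t) :
    prU (fun y : Fin n → Bool => ¬ (a ≤ tailCount t true y ∧ a ≤ tailCount t false y)) ≤
      2 * (1 / 2) ^ (3 * a) := by
  have hpow : (3 : ℝ) ^ a * (2 / 3) ^ (n - t) ≤ (1 / 2) ^ (3 * a) := by
    calc (3 : ℝ) ^ a * (2 / 3) ^ (n - t) ≤ 3 ^ a * (2 / 3) ^ (8 * a) := by
          gcongr ?_ * ?_
          exact pow_le_pow_of_le_one (by norm_num) (by norm_num) ha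
      _ = (3 * (2 / 3) ^ 8) ^ a := by rw [pow_mul, mul_pow]
      _ ≤ ((1 / 2) ^ 3) ^ a := by gcongr; norm_num
      _ = _ := by rw [pow_mul]
  calc _ ≤ prU (fun y : Fin n → Bool => tailCount t true y < a ∨ tailCount t false y < a) :=
        prU_mono fun y hy => by omega
    _ ≤ _ := prU_or_le _ _
    _ ≤ _ := by
      have := prU_tailCount_lt_le ht true a
      have := prU_tailCount_lt_le ht false a
      linarith

lemma restrictFirst_const_of_le {f : (Fin n → Bool) → Bool} {x : Fin n → Bool} {s t : ℕ}
    (hst : s ≤ t) (h : ∀ y z, restrictFirst f x s y = restrictFirst f x s z)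
    (y z : Fin n → Bool) : restrictFirst f x t y = restrictFirst f x t z := by
  have hr (w : Fin n → Bool) : restrictFirst f x t w =
      restrictFirst f x s (fun i => if (i : ℕ) < t then x i else w i) := by
    unfold restrictFirst
    congr 1
    ext i
    by_cases hs : (i : ℕ) < s
    · simp [hs, hs.trans_le hst]
    · simp [hs]
  rw [hr, hr, h]

lemma card_true_splice (x y : Fin n → Bool) (t : ℕ) :
    (Finset.univ.filter fun i : Fin n => (if (i : ℕ) < t then x i else y i) = true).card =
      (Finset.univ.filter fun i : Fin n => (i : ℕ) < t ∧ x i = true).card +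
        tailCount t true y := by
  rw [tailCount, ← Finset.card_union_of_disjoint]
  · congr 1
    ext i
    by_cases hi : (i : ℕ) < t <;> simp [hi]
    omega
  · rw [Finset.disjoint_filter]
    intro i _ h1 h2
    omega

lemma exists_tailCount_true_eq {s k : ℕ} (hs : s ≤ n) (hk : k ≤ n - s) :
    ∃ z : Fin n → Bool, tailCount s true z = k := by
  rw [← card_filter_le_val hs] at hk
  obtain ⟨S, hS, hcard⟩ := Finset.exists_subset_card_eq hk
  refine ⟨fun i => decide (i ∈ S), ?_⟩
  rw [tailCount, ← hcard]
  congr 1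
  ext i
  have := @hS i
  simp at this ⊢
  exact this

/-- Fixing `a` further coordinates leaves every weight of the central window reachable. -/
lemma exists_restrictFirst_eq {f : (Fin n → Bool) → Bool} (hf : IsSymmetricFn f)
    (x y : Fin n → Bool) {t a : ℕ} (hta : t + a ≤ n)
    (h1 : a ≤ tailCount t true y) (h0 : a ≤ tailCount t false y) :
    ∃ z, restrictFirst f x (t + a) z = restrictFirst f x t y := by
  have hle : (Finset.univ.filter fun i : Fin n => (i : ℕ) < t + a ∧ x i = true).card ≤
      (Finset.univ.filter fun i : Fin n => (i : ℕ) < t ∧ x i = true).card + a := by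
    have hwin : (Finset.univ.filter fun i : Fin n => t ≤ (i : ℕ) ∧ (i : ℕ) < t + a).card ≤ a := by
      have hmap := Finset.card_le_card_of_injOn (s := Finset.univ.filter
        fun i : Fin n => t ≤ (i : ℕ) ∧ (i : ℕ) < t + a) (t := Finset.Ico t (t + a))
        (fun i => (i : ℕ)) (by intro i hi; simpa using hi)
        (fun i _ j _ hij => Fin.ext hij)
      simpa using hmap
    refine le_trans (le_trans (Finset.card_le_card ?_) (Finset.card_union_le _ _))
      (Nat.add_le_add_left hwin _)
    intro i hi
    simp only [Finset.mem_filter, Finset.mem_univ, true_and, Finset.mem_union] at hi ⊢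
    by_cases h : (i : ℕ) < t
    · exact Or.inl ⟨h, hi.2⟩
    · exact Or.inr ⟨by omega, hi.1⟩
  have hge : (Finset.univ.filter fun i : Fin n => (i : ℕ) < t ∧ x i = true).card ≤
      (Finset.univ.filter fun i : Fin n => (i : ℕ) < t + a ∧ x i = true).card := by
    refine Finset.card_le_card fun i hi => ?_
    simp only [Finset.mem_filter, Finset.mem_univ, true_and] at hi ⊢
    exact ⟨by omega, hi.2⟩
  have htot := tailCount_true_add_false (t := t) (by omega) y
  obtain ⟨z, hz⟩ := exists_tailCount_true_eq (n := n) (s := t + a)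
    (k := (Finset.univ.filter fun i : Fin n => (i : ℕ) < t ∧ x i = true).card +
      tailCount t true y -
      (Finset.univ.filter fun i : Fin n => (i : ℕ) < t + a ∧ x i = true).card) hta (by omega)
  refine ⟨z, hf _ _ ?_⟩
  rw [card_true_splice, card_true_splice, hz]
  omega

lemma biasU_restrictFirst_self (f : (Fin n → Bool) → Bool) (x : Fin n → Bool) :
    biasU (restrictFirst f x n) ≤ 0 :=
  biasU_nonpos_of_const fun y z => by simp [restrictFirst]

lemma tauStop_le (f : (Fin n → Bool) → Bool) {ε : ℝ} (hε : 0 ≤ ε) (x : Fin n → Bool) :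
    tauStop f ε x ≤ n :=
  Nat.sInf_le ((biasU_restrictFirst_self f x).trans hε)

lemma biasU_restrictFirst_tauStop_zero (f : (Fin n → Bool) → Bool) (x : Fin n → Bool) :
    biasU (restrictFirst f x (tauStop f 0 x)) ≤ 0 :=
  Nat.sInf_mem (s := {t : ℕ | biasU (restrictFirst f x t) ≤ 0}) ⟨n, biasU_restrictFirst_self f x⟩

lemma tauStop_le_tauStop_zero (f : (Fin n → Bool) → Bool) {ε : ℝ} (hε : 0 ≤ ε)
    (x : Fin n → Bool) : tauStop f ε x ≤ tauStop f 0 x :=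
  Nat.sInf_le ((biasU_restrictFirst_tauStop_zero f x).trans hε)

/-- While the bias is large, a symmetric function stays nonconstant for a further fraction
(at least one in eight) of the remaining coordinates, unless few of these are left. -/
lemma exists_add_lt_tauStop_zero {f : (Fin n → Bool) → Bool} (hf : IsSymmetricFn f) {ε : ℝ}
    (hε : 0 < ε) (hε' : ε ≤ 1 / 2) (x : Fin n → Bool) {t : ℕ} (ht : t < tauStop f ε x) :
    ∃ a : ℕ, t + a < tauStop f 0 x ∧
      (n : ℝ) - t ≤ 11 * (1 + Real.logb 2 (1 / ε)) * (a + 1) := by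
  have htn : t < n := ht.trans_le (tauStop_le f hε.le x)
  have hbias : ε < biasU (restrictFirst f x t) := not_le.mp (Nat.notMem_of_lt_sInf ht)
  set L := 1 + Real.logb 2 (1 / ε) with hL
  have hL2 : 2 ≤ L := by
    have : (1 : ℝ) ≤ Real.logb 2 (1 / ε) := by
      rw [Real.le_logb_iff_rpow_le (by norm_num) (by positivity), le_div_iff₀ hε, Real.rpow_one]
      linarith
    linarith
  obtain ⟨a, ha⟩ : ∃ a, a = (n - t) / 8 := ⟨_, rfl⟩
  have hnt : (n : ℝ) - t ≤ 8 * (a + 1) := by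
    have : n ≤ 8 * (a + 1) + t := by omega
    have : (n : ℝ) ≤ 8 * (a + 1) + t := by exact_mod_cast this
    linarith
  by_cases haL : (3 * a : ℝ) < L
  · refine ⟨0, ?_, ?_⟩
    · simpa using ht.trans_le (tauStop_le_tauStop_zero f hε.le x)
    · push_cast
      linarith
  · refine ⟨a, ?_, hnt.trans (by gcongr; linarith)⟩
    by_contra! hle
    have hconst := restrictFirst_const_of_le hle
      (eq_of_biasU_nonpos (biasU_restrictFirst_tauStop_zero f x))
    have hcentral := biasU_le_prU_of_const_on (f := restrictFirst f x t)
      (p := fun y => a ≤ tailCount t true y ∧ a ≤ tailCount t false y) (by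
        rintro y y' ⟨h1, h0⟩ ⟨h1', h0'⟩
        obtain ⟨z, hz⟩ := exists_restrictFirst_eq hf x y (t := t) (by omega) h1 h0
        obtain ⟨z', hz'⟩ := exists_restrictFirst_eq hf x y' (t := t) (by omega) h1' h0'
        rw [← hz, ← hz', hconst])
    have htail := prU_not_central_le (n := n) (t := t) (a := a) htn.le (by omega)
    have hsmall : 2 * (1 / 2 : ℝ) ^ (3 * a) ≤ ε := by
      have h2 : Real.logb 2 (2 / ε) ≤ ((3 * a : ℕ) : ℝ) := by
        have : Real.logb 2 (2 / ε) = L := by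
          rw [hL, show (2 : ℝ) / ε = 2 * (1 / ε) by ring,
            Real.logb_mul (by norm_num) (by positivity), Real.logb_self_eq_one (by norm_num)]
        rw [this]
        push_cast
        linarith
      rw [Real.logb_le_iff_le_rpow (by norm_num) (by positivity), Real.rpow_natCast,
        div_le_iff₀ hε] at h2
      rw [one_div, inv_pow, ← div_eq_mul_inv, div_le_iff₀ (by positivity)]
      linarith
    linarith

/-- Costs of `k` consecutive queries starting at `t` are bounded below by `k` times the first. -/
lemma mul_le_sum_of_monotone {c : Fin n → ℝ} (hc : ∀ i, 0 ≤ c i)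
    (hmono : ∀ i j : Fin n, i ≤ j → c i ≤ c j) (i : Fin n) {a T : ℕ}
    (h : (i : ℕ) + a < T) (hT : T ≤ n) :
    ((a : ℝ) + 1) * c i ≤ ∑ j : Fin n, c j * if (j : ℕ) + 1 ≤ T then 1 else 0 := by
  have hcard : a + 1 ≤ (Finset.univ.filter
      fun j : Fin n => (i : ℕ) ≤ j ∧ (j : ℕ) + 1 ≤ T).card := by
    have hinj := Finset.card_le_card_of_injOn (s := (Finset.univ : Finset (Fin (a + 1))))
      (t := Finset.univ.filter fun j : Fin n => (i : ℕ) ≤ j ∧ (j : ℕ) + 1 ≤ T)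
      (fun k => ⟨i + k, by omega⟩) (by
        intro k _
        simp only [Finset.coe_filter, Finset.mem_univ, true_and, Set.mem_ofPred_eq]
        omega)
      (fun k _ l _ hkl => by simpa [Fin.ext_iff] using hkl)
    simpa using hinj
  calc ((a : ℝ) + 1) * c i
      ≤ (Finset.univ.filter fun j : Fin n => (i : ℕ) ≤ j ∧ (j : ℕ) + 1 ≤ T).card * c i := by
        gcongr
        · exact hc i
        · exact_mod_cast hcard
    _ = ∑ j : Fin n, if (i : ℕ) ≤ j ∧ (j : ℕ) + 1 ≤ T then c i else 0 := by
        rw [← Finset.sum_filter]; simp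
    _ ≤ _ := by
        refine Finset.sum_le_sum fun j _ => ?_
        by_cases h2 : (j : ℕ) + 1 ≤ T
        · by_cases h1 : (i : ℕ) ≤ j
          · simpa [h1, h2] using hmono i j h1
          · simpa [h1, h2] using hc j
        · simp [h2]

lemma sum_cost_le {f : (Fin n → Bool) → Bool} (hf : IsSymmetricFn f) {ε : ℝ}
    (hε : 0 < ε) (hε' : ε ≤ 1 / 2) {c : Fin n → ℝ} (hc : ∀ i, 0 ≤ c i)
    (hmono : ∀ i j : Fin n, i ≤ j → c i ≤ c j) (x : Fin n → Bool) :
    ∑ i : Fin n, c i * ((if (i : ℕ) + 1 ≤ tauStop f ε x then 1 else 0) +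
        ((n : ℝ) - ((i : ℕ) + 1)) * if tauStop f ε x = (i : ℕ) + 1 then 1 else 0) ≤
      12 * (1 + Real.logb 2 (1 / ε)) *
        ∑ i : Fin n, c i * if (i : ℕ) + 1 ≤ tauStop f 0 x then 1 else 0 := by
  have hlog : 0 ≤ Real.logb 2 (1 / ε) :=
    Real.logb_nonneg (by norm_num) (by rw [le_div_iff₀ hε]; linarith)
  set S := ∑ i : Fin n, c i * if (i : ℕ) + 1 ≤ tauStop f 0 x then (1 : ℝ) else 0 with hS
  have hS0 : 0 ≤ S := Finset.sum_nonneg fun i _ => mul_nonneg (hc i) (by positivity)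
  have hfirst : ∑ i : Fin n, c i * (if (i : ℕ) + 1 ≤ tauStop f ε x then (1 : ℝ) else 0) ≤ S := by
    refine Finset.sum_le_sum fun i _ => mul_le_mul_of_nonneg_left ?_ (hc i)
    have := tauStop_le_tauStop_zero f hε.le x
    split_ifs <;> first | omega | norm_num
  have hsecond : ∑ i : Fin n, c i * (((n : ℝ) - ((i : ℕ) + 1)) *
      if tauStop f ε x = (i : ℕ) + 1 then 1 else 0) ≤ 11 * (1 + Real.logb 2 (1 / ε)) * S := by
    by_cases hτ : ∃ i : Fin n, tauStop f ε x = (i : ℕ) + 1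
    · obtain ⟨i, hi⟩ := hτ
      rw [Finset.sum_eq_single i _ (by simp)]
      · obtain ⟨a, ha, hna⟩ :=
          exists_add_lt_tauStop_zero hf hε hε' x (t := (i : ℕ)) (by omega)
        have hsum := mul_le_sum_of_monotone hc hmono i ha (tauStop_le f le_rfl x)
        rw [if_pos hi, mul_one]
        calc c i * ((n : ℝ) - ((i : ℕ) + 1))
            ≤ c i * (11 * (1 + Real.logb 2 (1 / ε)) * (a + 1)) :=
              mul_le_mul_of_nonneg_left (by linarith) (hc i)
          _ = 11 * (1 + Real.logb 2 (1 / ε)) * ((a + 1) * c i) := by ring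
          _ ≤ _ := mul_le_mul_of_nonneg_left hsum (by positivity)
      · intro j _ hj
        rw [if_neg, mul_zero, mul_zero]
        intro h
        exact hj (Fin.ext (by omega))
    · push Not at hτ
      simp only [hτ, if_false, mul_zero, Finset.sum_const_zero]
      positivity
  simp_rw [mul_add (c _)]
  rw [Finset.sum_add_distrib]
  nlinarith [mul_nonneg hlog hS0]

/-- There is a universal constant `C > 0` such that for every `n ≥ 1`, `ε ∈ (0, 1/2]`,
symmetric `f : {0,1}^n → {0,1}` and nondecreasing nonnegative costs
`0 ≤ c_1 ≤ … ≤ c_n` (here `c i` with `i : Fin n` is the cost `c_{i+1}`):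
`Σ_{i=1}^n c_i·(Pr[τ^(ε) ≥ i] + (n − i)·Pr[τ^(ε) = i]) ≤
  C·(1 + log₂(1/ε))·Σ_{i=1}^n c_i·Pr[τ^(0) ≥ i]`. -/
theorem symmetric_cost_comparison :
    ∃ C : ℝ, 0 < C ∧
      ∀ n : ℕ, 1 ≤ n → ∀ ε : ℝ, 0 < ε → ε ≤ 1 / 2 →
        ∀ f : (Fin n → Bool) → Bool, IsSymmetricFn f →
          ∀ c : Fin n → ℝ, (∀ i, 0 ≤ c i) → (∀ i j : Fin n, i ≤ j → c i ≤ c j) →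
            ∑ i : Fin n, c i *
                (prU (fun x : Fin n → Bool => (i : ℕ) + 1 ≤ tauStop f ε x) +
                  ((n : ℝ) - ((i : ℕ) + 1)) *
                    prU (fun x : Fin n → Bool => tauStop f ε x = (i : ℕ) + 1)) ≤
              C * (1 + Real.logb 2 (1 / ε)) *
                ∑ i : Fin n, c i * prU (fun x : Fin n → Bool => (i : ℕ) + 1 ≤ tauStop f 0 x) := by
  refine ⟨12, by norm_num, fun n _ ε hε hε' f hf c hc hmono => ?_⟩
  have hswap (b : Fin n → ℝ) (p : Fin n → (Fin n → Bool) → Prop)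
      [∀ i, DecidablePred (p i)] :
      ∑ i, b i * prU (p i) =
        (∑ x, ∑ i, b i * if p i x then (1 : ℝ) else 0) / (Fintype.card (Fin n → Bool) : ℝ) := by
    rw [Finset.sum_comm, Finset.sum_div]
    refine Finset.sum_congr rfl fun i _ => ?_
    rw [prU_eq_sum_ite, ← Finset.mul_sum, mul_div_assoc]
  simp_rw [mul_add (c _), ← mul_assoc (c _)]
  rw [Finset.sum_add_distrib, hswap, hswap, hswap, ← add_div, ← Finset.sum_add_distrib,
    ← mul_div_assoc, Finset.mul_sum]
  gcongr with x
  rw [← Finset.sum_add_distrib]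
  simpa only [mul_add, mul_assoc] using sum_cost_le hf hε hε' hc hmono x
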